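/- Let n ≥ 1, let μ₁, …, μₙ ∈ ℝ, let σ > 0, and set μ̄ = ∑_{i=1}^n μᵢ². Then for every ψ ≥ 0, the supremum of ∏_{i=1}^n exp(−(θᵢ − μᵢ)²/(2σ²)) over all (θ₁, …, θₙ) ∈ ℝⁿ satisfying θ₁² + ⋯ + θₙ² = ψ equals exp(−(√ψ − √μ̄)²/(2σ²)). -/

import Mathlib

open Real Finset

/-- The possibility function of a sum of squares of uncertain variables independently
described by normal possibility functions `N̄(μᵢ, σ²)` is the (non-central) chi-squared
possibility function. -/
theorem stmt_0 (n : ℕ) (hn : 1 ≤ n) (μ : Fin n → ℝ) (σ : ℝ) (hσ : 0 < σ)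
    (μbar : ℝ) (hμbar : μbar = ∑ i, (μ i) ^ 2) (ψ : ℝ) (hψ : 0 ≤ ψ) :
    sSup {p : ℝ | ∃ θ : Fin n → ℝ, (∑ i, (θ i) ^ 2) = ψ ∧
        p = ∏ i, Real.exp (-(θ i - μ i) ^ 2 / (2 * σ ^ 2))} =
      Real.exp (-(Real.sqrt ψ - Real.sqrt μbar) ^ 2 / (2 * σ ^ 2)) := by
  have hm : 0 ≤ μbar := by rw [hμbar]; positivity
  have hprod : ∀ θ : Fin n → ℝ, (∑ i, (θ i) ^ 2) = ψ →
      ∏ i, Real.exp (-(θ i - μ i) ^ 2 / (2 * σ ^ 2)) =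
        Real.exp (-(ψ - 2 * (∑ i, θ i * μ i) + μbar) / (2 * σ ^ 2)) := by
    intro θ hθ
    rw [← Real.exp_sum, ← Finset.sum_div]
    congr 2
    rw [← hθ, hμbar, Finset.mul_sum, ← Finset.sum_sub_distrib, ← Finset.sum_add_distrib,
      ← Finset.sum_neg_distrib]
    exact Finset.sum_congr rfl fun i _ => by ring
  have hrhs : (Real.sqrt ψ - Real.sqrt μbar) ^ 2 =
      ψ - 2 * (Real.sqrt ψ * Real.sqrt μbar) + μbar := by
    have h1 := Real.sq_sqrt hψ
    have h2 := Real.sq_sqrt hm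
    linear_combination h1 + h2
  have hex : ∃ θ : Fin n → ℝ, (∑ i, (θ i) ^ 2) = ψ ∧
      ∑ i, θ i * μ i = Real.sqrt ψ * Real.sqrt μbar := by
    rcases hm.eq_or_lt with h0 | hpos
    · have hz : ∀ i, μ i = 0 := by
        intro i
        have h := (Finset.sum_eq_zero_iff_of_nonneg
          (fun i _ => sq_nonneg (μ i))).1 (hμbar.symm.trans h0.symm) i (Finset.mem_univ i)
        exact pow_eq_zero_iff (two_ne_zero) |>.1 h
      refine ⟨fun i => if i = ⟨0, hn⟩ then Real.sqrt ψ else 0, ?_, ?_⟩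
      · simp [ite_pow, Real.sq_sqrt hψ]
      · simp [hz, ← h0]
    · have hs : Real.sqrt μbar ≠ 0 := (Real.sqrt_pos.2 hpos).ne'
      have h2 := Real.sq_sqrt hm
      refine ⟨fun i => Real.sqrt ψ / Real.sqrt μbar * μ i, ?_, ?_⟩
      · simp only [mul_pow]
        rw [← Finset.mul_sum, ← hμbar, div_pow, h2, Real.sq_sqrt hψ]
        field_simp
      · have : ∑ i, Real.sqrt ψ / Real.sqrt μbar * μ i * μ i
            = Real.sqrt ψ / Real.sqrt μbar * μbar := by
          rw [hμbar, Finset.mul_sum]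
          exact Finset.sum_congr rfl fun i _ => by ring
        rw [this]
        nth_rewrite 2 [← h2]
        field_simp
  apply IsGreatest.csSup_eq
  constructor
  · obtain ⟨θ, h1, h2⟩ := hex
    exact ⟨θ, h1, by rw [hprod θ h1, h2, hrhs]⟩
  · rintro p ⟨θ, h1, rfl⟩
    rw [hprod θ h1, hrhs]
    have hcs := Real.sum_mul_le_sqrt_mul_sqrt Finset.univ θ μ
    rw [h1, ← hμbar] at hcs
    apply Real.exp_le_exp.2
    apply div_le_div_of_nonneg_right _ (by positivity)
    linarith
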